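/- Let H be a positive self-adjoint operator on a Hilbert space and A, B closed subspaces such that (φ_A, e^{-tH} φ_B) = 0 for all t ∈ (0, D²/(4t) arbitrary), more precisely: suppose |(φ_A, e^{-tH}φ_B)| ≤ e^{-D²/(4t)}‖φ_A‖‖φ_B‖ for all t > 0 and all φ_A ∈ A, φ_B ∈ B, where D > 0. Then (φ_A, cos(t H^{1/2}) φ_B) = 0 for all φ_A ∈ A, φ_B ∈ B and all t ∈ [−D, D]. -/

import Mathlib

open RealInnerProductSpace

open MeasureTheory Filter Topology

lemma integrable_exp_neg_mul_sq_mul {f : ℝ → ℝ} (hf : Continuous f) {M : ℝ}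
    (hM : ∀ s, |f s| ≤ M) {b : ℝ} (hb : 0 < b) :
    Integrable fun s => Real.exp (-b * s ^ 2) * f s :=
  (integrable_exp_neg_mul_sq hb).mul_bdd (c := M) hf.aestronglyMeasurable (.of_forall hM)

lemma hasSum_one_sub_exp_neg (x : ℝ) :
    HasSum (fun k : ℕ => (-1) ^ k / ((k + 1).factorial : ℝ) * x ^ (k + 1))
      (1 - Real.exp (-x)) := by
  have h : HasSum (fun k : ℕ => (-x) ^ k / (k.factorial : ℝ)) (Real.exp (-x)) := by
    rw [Real.exp_eq_exp_ℝ]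
    exact NormedSpace.expSeries_div_hasSum_exp (-x)
  have h' := ((hasSum_nat_add_iff' 1).2 h).neg
  simp only [Finset.range_one, Finset.sum_singleton, pow_zero, Nat.factorial_zero, Nat.cast_one,
    div_one, neg_sub] at h'
  refine h'.congr_fun ?_
  intro k
  rw [neg_pow x, pow_succ (-1 : ℝ)]
  ring

/-- Gaussian averages of size `O(e^{-b D²})` control the integral against the smoothed indicator
`s ↦ 1 - exp (-e^{n (w² - s²)})` of `[-w, w]`, by expanding the latter into Gaussians. -/
lemma abs_integral_one_sub_exp_neg_exp_mul_le {f : ℝ → ℝ} (hf : Continuous f) {M : ℝ}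
    (hM : ∀ s, |f s| ≤ M) {K D : ℝ}
    (hK : ∀ b : ℝ, 1 ≤ b → |∫ s, Real.exp (-b * s ^ 2) * f s| ≤ K * Real.exp (-b * D ^ 2))
    {w : ℝ} (hwD : w ^ 2 ≤ D ^ 2) {n : ℝ} (hn : 1 ≤ n) :
    |∫ s, (1 - Real.exp (-Real.exp (n * (w ^ 2 - s ^ 2)))) * f s|
      ≤ K * Real.exp (-n * (D ^ 2 - w ^ 2)) * Real.exp 1 := by
  have hK0 : 0 ≤ K := by
    have := (abs_nonneg _).trans (hK 1 le_rfl)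
    exact nonneg_of_mul_nonneg_left this (Real.exp_pos _)
  have hb (k : ℕ) : n ≤ (k + 1) * n := by nlinarith [Nat.cast_nonneg (α := ℝ) k]
  set c : ℕ → ℝ := fun k => (-1) ^ k / ((k + 1).factorial : ℝ) * Real.exp (n * w ^ 2) ^ (k + 1)
  set g : ℕ → ℝ → ℝ := fun k s => c k * (Real.exp (-((k + 1) * n) * s ^ 2) * f s)
  have hpt (s : ℝ) : HasSum (fun k => g k s)
      ((1 - Real.exp (-Real.exp (n * (w ^ 2 - s ^ 2)))) * f s) := by
    refine ((hasSum_one_sub_exp_neg (Real.exp (n * (w ^ 2 - s ^ 2)))).mul_right (f s)).congr_fun ?_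
    intro k
    have : Real.exp (n * (w ^ 2 - s ^ 2)) ^ (k + 1)
        = Real.exp (n * w ^ 2) ^ (k + 1) * Real.exp (-((k + 1) * n) * s ^ 2) := by
      rw [← Real.exp_nat_mul, ← Real.exp_nat_mul, ← Real.exp_add]
      congr 1
      push_cast
      ring
    simp only [g, c, this]
    ring
  have hc (k : ℕ) : |c k| = Real.exp (n * w ^ 2) ^ (k + 1) / ((k + 1).factorial : ℝ) := by
    simp only [c, abs_mul, abs_div, abs_pow, abs_neg, abs_one, one_pow, Nat.abs_cast, Real.abs_exp]
    ring
  have hint (k : ℕ) : Integrable (g k) :=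
    (integrable_exp_neg_mul_sq_mul hf hM (by linarith [hb k])).const_mul _
  have hsum : Summable fun k => ∫ s, ‖g k s‖ := by
    refine .of_nonneg_of_le (fun k => integral_nonneg fun s => norm_nonneg _) (fun k => ?_)
      (((summable_nat_add_iff 1).2 (Real.summable_pow_div_factorial (Real.exp (n * w ^ 2)))).mul_right
        (∫ s, Real.exp (-1 * s ^ 2) * M))
    rw [← hc, ← integral_const_mul]
    refine integral_mono (hint k).norm
      (((integrable_exp_neg_mul_sq one_pos).mul_const M).const_mul _) fun s => ?_
    simp only [g, norm_mul, Real.norm_eq_abs, Real.abs_exp]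
    gcongr
    · linarith [hb k]
    · exact hM s
  have key := hasSum_integral_of_summable_integral_norm hint hsum
  simp only [fun s => (hpt s).tsum_eq] at key
  rw [← Real.norm_eq_abs, ← key.tsum_eq]
  have hexp : HasSum (fun k : ℕ => 1 / (k.factorial : ℝ)) (Real.exp 1) := by
    simpa [Real.exp_eq_exp_ℝ] using NormedSpace.expSeries_div_hasSum_exp (1 : ℝ)
  refine tsum_of_norm_bounded (hexp.mul_left _) fun k => ?_
  simp only [g]
  rw [integral_const_mul, norm_mul, Real.norm_eq_abs, Real.norm_eq_abs, hc]
  calc Real.exp (n * w ^ 2) ^ (k + 1) / ((k + 1).factorial : ℝ)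
        * |∫ s, Real.exp (-((k + 1) * n) * s ^ 2) * f s|
      ≤ Real.exp (n * w ^ 2) ^ (k + 1) / ((k + 1).factorial : ℝ)
        * (K * Real.exp (-((k + 1) * n) * D ^ 2)) := by
        gcongr
        exact hK _ (hn.trans (hb k))
    _ = K * Real.exp (-((k + 1) * n) * (D ^ 2 - w ^ 2)) * (1 / ((k + 1).factorial : ℝ)) := by
        have : Real.exp (-((k + 1) * n) * (D ^ 2 - w ^ 2))
            = Real.exp (n * w ^ 2) ^ (k + 1) * Real.exp (-((k + 1) * n) * D ^ 2) := by
          rw [← Real.exp_nat_mul, ← Real.exp_add]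
          congr 1
          push_cast
          ring
        rw [this]
        ring
    _ ≤ K * Real.exp (-n * (D ^ 2 - w ^ 2)) * (1 / (k.factorial : ℝ)) := by
        gcongr
        · exact hb k
        · exact k.le_succ

lemma tendsto_integral_one_sub_exp_neg_exp_mul {f : ℝ → ℝ} (hf : Continuous f) {M : ℝ}
    (hM : ∀ s, |f s| ≤ M) {w : ℝ} (hw : 0 < w) :
    Tendsto (fun n : ℝ => ∫ s, (1 - Real.exp (-Real.exp (n * (w ^ 2 - s ^ 2)))) * f s) atTop
      (𝓝 (∫ s in -w..w, f s)) := by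
  rw [intervalIntegral.integral_of_le (by linarith), ← integral_indicator measurableSet_Ioc]
  refine tendsto_integral_filter_of_dominated_convergence
    (fun s => Real.exp (w ^ 2) * (Real.exp (-1 * s ^ 2) * M)) (.of_forall fun n => ?_) ?_
    (((integrable_exp_neg_mul_sq one_pos).mul_const M).const_mul _) ?_
  · exact Continuous.aestronglyMeasurable (by fun_prop)
  · filter_upwards [eventually_ge_atTop 1] with n hn
    refine .of_forall fun s => ?_
    have hE := Real.exp_pos (n * (w ^ 2 - s ^ 2))
    have h1 : Real.exp (-Real.exp (n * (w ^ 2 - s ^ 2))) ≤ 1 := Real.exp_le_one_iff.2 (by linarith)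
    have h2 := Real.add_one_le_exp (-Real.exp (n * (w ^ 2 - s ^ 2)))
    have h3 : 1 - Real.exp (-Real.exp (n * (w ^ 2 - s ^ 2))) ≤ Real.exp (w ^ 2 - s ^ 2) := by
      rcases le_total (s ^ 2) (w ^ 2) with h | h
      · have := Real.one_le_exp (sub_nonneg.2 h)
        linarith [Real.exp_pos (-Real.exp (n * (w ^ 2 - s ^ 2)))]
      · have : Real.exp (n * (w ^ 2 - s ^ 2)) ≤ Real.exp (w ^ 2 - s ^ 2) :=
          Real.exp_le_exp.2 (by nlinarith)
        linarith
    have h4 : Real.exp (w ^ 2 - s ^ 2) = Real.exp (w ^ 2) * Real.exp (-1 * s ^ 2) := by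
      rw [← Real.exp_add]
      ring_nf
    rw [norm_mul, Real.norm_eq_abs, Real.norm_eq_abs, abs_of_nonneg (by linarith), ← mul_assoc,
      ← h4]
    exact mul_le_mul h3 (hM s) (abs_nonneg _) (Real.exp_pos _).le
  · have hae : ∀ᵐ s : ℝ, s ∉ ({w, -w} : Set ℝ) :=
      measure_eq_zero_iff_ae_notMem.1 ((Set.toFinite _).measure_zero _)
    filter_upwards [hae] with s hs
    simp only [Set.mem_insert_iff, Set.mem_singleton_iff, not_or] at hs
    have hne : s ^ 2 ≠ w ^ 2 := fun h => (sq_eq_sq_iff_eq_or_eq_neg.1 h).elim hs.1 hs.2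
    rcases hne.lt_or_gt with h | h
    · have hmem : s ∈ Set.Ioc (-w) w :=
        ⟨(abs_lt_of_sq_lt_sq' h hw.le).1, (abs_lt_of_sq_lt_sq' h hw.le).2.le⟩
      rw [Set.indicator_of_mem hmem]
      have : Tendsto (fun n : ℝ => n * (w ^ 2 - s ^ 2)) atTop atTop :=
        tendsto_id.atTop_mul_const (sub_pos.2 h)
      have := Real.tendsto_exp_neg_atTop_nhds_zero.comp (Real.tendsto_exp_atTop.comp this)
      simpa using (this.const_sub 1).mul_const (f s)
    · have hmem : s ∉ Set.Ioc (-w) w := fun hs' =>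
        h.not_ge (sq_le_sq' hs'.1.le hs'.2)
      rw [Set.indicator_of_notMem hmem]
      have : Tendsto (fun n : ℝ => n * (w ^ 2 - s ^ 2)) atTop atBot :=
        tendsto_id.atTop_mul_const_of_neg (sub_neg.2 h)
      have := (Real.continuous_exp.tendsto _).comp (Real.tendsto_exp_atBot.comp this).neg
      simpa [Function.comp_def] using (this.const_sub 1).mul_const (f s)

/-- An even bounded continuous function whose Gaussian averages are `O(e^{-b D²})` vanishes on
`[-D, D]`. -/
lemma eq_zero_of_abs_integral_exp_neg_mul_sq_mul_le {f : ℝ → ℝ} (hf : Continuous f)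
    (heven : ∀ s, f (-s) = f s) {M : ℝ} (hM : ∀ s, |f s| ≤ M) {K D : ℝ} (hD : 0 < D)
    (hK : ∀ b : ℝ, 1 ≤ b → |∫ s, Real.exp (-b * s ^ 2) * f s| ≤ K * Real.exp (-b * D ^ 2))
    {t : ℝ} (ht : t ∈ Set.Icc (-D) D) : f t = 0 := by
  have hzero {w : ℝ} (hw : w ∈ Set.Ioo 0 D) : ∫ s in -w..w, f s = 0 := by
    have hlt : 0 < D ^ 2 - w ^ 2 := sub_pos.2 (pow_lt_pow_left₀ hw.2 hw.1.le two_ne_zero)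
    refine tendsto_nhds_unique (tendsto_integral_one_sub_exp_neg_exp_mul hf hM hw.1)
      (squeeze_zero_norm' (a := fun n => K * Real.exp (-n * (D ^ 2 - w ^ 2)) * Real.exp 1) ?_ ?_)
    · filter_upwards [eventually_ge_atTop 1] with n hn
      exact abs_integral_one_sub_exp_neg_exp_mul_le hf hM hK (sub_pos.1 hlt).le hn
    · have : Tendsto (fun n : ℝ => n * (D ^ 2 - w ^ 2)) atTop atTop :=
        tendsto_id.atTop_mul_const hlt
      have := Real.tendsto_exp_neg_atTop_nhds_zero.comp this
      simpa [Function.comp_def] using (this.const_mul K).mul_const (Real.exp 1)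
  have hpos : Set.EqOn f 0 (Set.Ioo 0 D) := fun w hw => by
    have hd (x : ℝ) : HasDerivAt (fun u => ∫ s in 0..u, f s) (f x) x :=
      intervalIntegral.integral_hasDerivAt_right (hf.intervalIntegrable _ _)
        hf.aestronglyMeasurable.stronglyMeasurableAtFilter hf.continuousAt
    have h1 := (hd w).sub ((hd (-w)).comp w (hasDerivAt_neg w))
    have h2 : HasDerivAt (fun _ : ℝ => (0 : ℝ)) (f w - f (-w) * -1) w := by
      refine h1.congr_of_eventuallyEq ?_
      filter_upwards [isOpen_Ioo.mem_nhds hw] with u hu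
      rw [← hzero hu]
      exact (intervalIntegral.integral_interval_sub_left (hf.intervalIntegrable _ _)
        (hf.intervalIntegrable _ _)).symm
    have := h2.unique (hasDerivAt_const w (0 : ℝ))
    rw [heven] at this
    simp only [Pi.zero_apply]
    linarith
  have hIcc : Set.EqOn f 0 (Set.Icc 0 D) := by
    rw [← closure_Ioo hD.ne]
    exact hpos.closure hf continuous_zero
  rcases le_total 0 t with h | h
  · exact hIcc ⟨h, ht.2⟩
  · rw [← heven]
    exact hIcc ⟨by linarith, by linarith [ht.1]⟩

/-- Finite propagation speed from Gaussian `L₂` off-diagonal bounds.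
`S t = e^{-tH}` and `C s = cos(s H^{1/2})` for a positive self-adjoint operator `H`
are encoded via the spectral-calculus facts: `‖cos(sH^{1/2})‖ ≤ 1`, evenness, strong
(weak) continuity in `s`, and the Hadamard transmutation formula
`(φ, e^{-tH}χ) = (4πt)^{-1/2} ∫_ℝ e^{-s²/(4t)} (φ, cos(sH^{1/2})χ) ds`.
If `|(φ_A, e^{-tH}φ_B)| ≤ e^{-D²/(4t)} ‖φ_A‖ ‖φ_B‖` for all `t > 0`, `φ_A ∈ A`,
`φ_B ∈ B`, then `(φ_A, cos(tH^{1/2})φ_B) = 0` for all `t ∈ [−D, D]`. -/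
theorem wave_vanishes_of_gaussian_bound {H : Type*}
    [NormedAddCommGroup H] [InnerProductSpace ℝ H]
    (S C : ℝ → H →L[ℝ] H)
    (hCnorm : ∀ s, ‖C s‖ ≤ 1)
    (hCeven : ∀ s, C (-s) = C s)
    (hCcont : ∀ φ χ : H, Continuous fun s => ⟪φ, C s χ⟫)
    (htrans : ∀ t : ℝ, 0 < t → ∀ φ χ : H,
      ⟪φ, S t χ⟫ = (4 * Real.pi * t) ^ (-(1 : ℝ) / 2)
        * ∫ s : ℝ, Real.exp (-s ^ 2 / (4 * t)) * ⟪φ, C s χ⟫)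
    (A B : Submodule ℝ H) (hA : IsClosed (A : Set H)) (hB : IsClosed (B : Set H))
    (D : ℝ) (hD : 0 < D)
    (hgauss : ∀ t : ℝ, 0 < t → ∀ φA ∈ A, ∀ φB ∈ B,
      |⟪φA, S t φB⟫| ≤ Real.exp (-D ^ 2 / (4 * t)) * ‖φA‖ * ‖φB‖) :
    ∀ t ∈ Set.Icc (-D) D, ∀ φA ∈ A, ∀ φB ∈ B, ⟪φA, C t φB⟫ = 0 := by
  intro t ht φ hφ χ hχ
  refine eq_zero_of_abs_integral_exp_neg_mul_sq_mul_le (f := fun s => ⟪φ, C s χ⟫)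
    (M := ‖φ‖ * ‖χ‖) (K := Real.pi ^ ((1 : ℝ) / 2) * (‖φ‖ * ‖χ‖))
    (hCcont φ χ) (fun s => by rw [hCeven]) (fun s => ?_) hD (fun b hb => ?_) ht
  · exact (abs_real_inner_le_norm _ _).trans
      (mul_le_mul_of_nonneg_left ((C s).le_of_opNorm_le (hCnorm s) χ |>.trans_eq (one_mul _))
        (norm_nonneg _))
  · have hb0 : 0 < b := one_pos.trans_le hb
    have hdiv (x : ℝ) : -x ^ 2 / (4 * (1 / (4 * b))) = -b * x ^ 2 := by
      field_simp
    have hT : 0 < 1 / (4 * b) := by positivity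
    have h := hgauss _ hT φ hφ χ hχ
    simp only [htrans _ hT, hdiv] at h
    have hpi : 4 * Real.pi * (1 / (4 * b)) = Real.pi / b := by
      field_simp
    have hP : 0 < Real.pi / b := by positivity
    rw [hpi, neg_div, Real.rpow_neg hP.le, abs_mul, abs_of_pos (by positivity),
      inv_mul_le_iff₀ (by positivity)] at h
    refine h.trans ?_
    have hle : (Real.pi / b) ^ ((1 : ℝ) / 2) ≤ Real.pi ^ ((1 : ℝ) / 2) := by
      gcongr
      exact div_le_self Real.pi_pos.le hb
    calc _ ≤ Real.pi ^ ((1 : ℝ) / 2) * (Real.exp (-b * D ^ 2) * ‖φ‖ * ‖χ‖) := by gcongr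
      _ = _ := by ring
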